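/- arXiv:0903.2866 — 6 statements merged into one kernel-verified Lean document; each statement's English description precedes it below -/
import Mathlib

section
/- Let p be a prime and let d be a positive integer with d ∈ U_p. Then there exists a positive integer k such that v_2(ℓ_p(r)) = k for every odd prime factor r of d (in particular, every odd prime factor r of d is distinct from p, so ℓ_p(r) is defined, and the 2-adic valuation of ℓ_p(r) is the same for all such r). -/
theorem padicValNat_two_eq_succ_of_dvd_two_mul {m n : ℕ} (hn : n ≠ 0) (h : m ∣ 2 * n)
    (h' : ¬ m ∣ n) : padicValNat 2 m = padicValNat 2 n + 1 := by
  obtain ⟨c, hc⟩ := h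
  have hm : m ≠ 0 := by rintro rfl; omega
  have hc0 : c ≠ 0 := by rintro rfl; omega
  have hodd : ¬ 2 ∣ c := by
    rintro ⟨b, rfl⟩
    exact h' ⟨b, by linarith⟩
  have hval := congrArg (padicValNat 2) hc
  rw [padicValNat.mul two_ne_zero hn, padicValNat.mul hm hc0, padicValNat.self one_lt_two,
    padicValNat.eq_zero_of_not_dvd hodd] at hval
  omega

theorem padicValNat_two_orderOf_of_pow_eq_neg_one {R : Type*} [Ring R] (hR : (-1 : R) ≠ 1)
    {x : R} {n : ℕ} (hn : n ≠ 0) (hx : x ^ n = -1) :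
    padicValNat 2 (orderOf x) = padicValNat 2 n + 1 := by
  refine padicValNat_two_eq_succ_of_dvd_two_mul hn ?_ ?_
  · rw [orderOf_dvd_iff_pow_eq_one, mul_comm, pow_mul, hx, neg_one_sq]
  · rwa [orderOf_dvd_iff_pow_eq_one, hx]

/-- Let `p` be a prime and `d` a positive integer in `U_p`
(i.e. `d ∣ p ^ n + 1` for some `n ≥ 1`).  Then there is a positive integer `k`
such that every odd prime factor `r` of `d` is distinct from `p` and satisfies
`v₂(ℓ_p(r)) = k`, where `ℓ_p(r)` is the multiplicative order of `p` mod `r`. -/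
theorem rank_stats_stmt0 (p : ℕ) (hp : p.Prime) (d : ℕ) (hd : 0 < d)
    (hUp : ∃ n : ℕ, 1 ≤ n ∧ d ∣ p ^ n + 1) :
    ∃ k : ℕ, 1 ≤ k ∧ ∀ r : ℕ, r.Prime → Odd r → r ∣ d →
      r ≠ p ∧ padicValNat 2 (orderOf ((p : ZMod r))) = k := by
  obtain ⟨n, hn, hdn⟩ := hUp
  refine ⟨padicValNat 2 n + 1, by omega, fun r hr hodd hrd => ⟨?_, ?_⟩⟩
  · rintro rfl
    have h := (Nat.dvd_add_right (dvd_pow_self r (by omega : n ≠ 0))).mp (hrd.trans hdn)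
    exact hr.one_lt.ne' (Nat.dvd_one.mp h)
  · have : Fact (2 < r) := ⟨lt_of_le_of_ne hr.two_le (by rintro rfl; exact absurd hodd (by decide))⟩
    refine padicValNat_two_orderOf_of_pow_eq_neg_one ZMod.neg_one_ne_one (by omega) ?_
    have h := (ZMod.natCast_eq_zero_iff (p ^ n + 1) r).mpr (hrd.trans hdn)
    push_cast at h
    exact eq_neg_of_add_eq_zero_left h
end

section
/- Let p > 2 be a prime and let d ∈ U_p. If every odd prime factor r of d satisfies v_2(ℓ_p(r)) = 1, then v_2(d) ≤ v_2(p+1). If some odd prime factor r of d satisfies v_2(ℓ_p(r)) > 1, then v_2(d) ≤ 1. -/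
/-- For odd `p` and odd `n`, the powers of two dividing `p ^ n + 1` divide `p + 1`. -/
theorem two_pow_dvd_add_one_of_dvd_pow_add_one {p n k : ℕ} (hp : Odd p) (hn : Odd n)
    (h : 2 ^ k ∣ p ^ n + 1) : 2 ^ k ∣ p + 1 := by
  have key : emultiplicity (2 : ℤ) ((p : ℤ) ^ n - (-1) ^ n) =
      emultiplicity (2 : ℤ) ((p : ℤ) - (-1)) := by
    apply emultiplicity_pow_sub_pow_of_prime Int.prime_two
    · obtain ⟨m, rfl⟩ := hp
      exact ⟨m + 1, by push_cast; ring⟩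
    · obtain ⟨m, rfl⟩ := hp
      push_cast
      omega
    · obtain ⟨m, rfl⟩ := hn
      push_cast
      omega
  rw [hn.neg_one_pow, sub_neg_eq_add, sub_neg_eq_add] at key
  have h' : (2 : ℤ) ^ k ∣ (p : ℤ) ^ n + 1 := by exact_mod_cast h
  rw [pow_dvd_iff_le_emultiplicity, key, ← pow_dvd_iff_le_emultiplicity] at h'
  exact_mod_cast h'

theorem not_four_dvd_pow_add_one {p n : ℕ} (hp : Odd p) (hn : Even n) :
    ¬ 4 ∣ p ^ n + 1 := by
  obtain ⟨m, rfl⟩ := hn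
  have hm : (p ^ m) ^ 2 % 8 = 1 := by
    have := Nat.odd_iff.mp (hp.pow (n := m))
    rcases (by omega : p ^ m % 8 = 1 ∨ p ^ m % 8 = 3 ∨ p ^ m % 8 = 5 ∨ p ^ m % 8 = 7)
      with h | h | h | h <;> simp [Nat.pow_mod, h]
  rw [pow_add, ← sq]
  omega

theorem padicValNat_two_le_one_of_dvd_pow_add_one {p n d : ℕ} (hp : Odd p) (hn : Even n)
    (h : d ∣ p ^ n + 1) : padicValNat 2 d ≤ 1 := by
  by_contra! hlt
  exact not_four_dvd_pow_add_one hp hn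
    (((pow_dvd_pow 2 hlt).trans pow_padicValNat_dvd).trans h)

/-- If `r` divides `p ^ n + 1` with `n` odd, the order of `p` modulo `r` is not divisible
by four. -/
theorem padicValNat_two_orderOf_le_one {p n r : ℕ} (hn : Odd n) (h : r ∣ p ^ n + 1) :
    padicValNat 2 (orderOf (p : ZMod r)) ≤ 1 := by
  have hneg : (p : ZMod r) ^ n = -1 :=
    eq_neg_of_add_eq_zero_left (by exact_mod_cast (ZMod.natCast_eq_zero_iff _ r).mpr h)
  have hord : orderOf (p : ZMod r) ∣ n * 2 :=
    orderOf_dvd_of_pow_eq_one (by rw [pow_mul, hneg, neg_one_sq])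
  by_contra! hlt
  have h4 : 2 ^ 2 ∣ n * 2 := ((pow_dvd_pow 2 hlt).trans pow_padicValNat_dvd).trans hord
  obtain ⟨m, rfl⟩ := hn
  omega

/-- Let `p > 2` be prime and `d ∈ U_p` (i.e. `d ∣ p ^ n + 1`
for some `n ≥ 1`).  If every odd prime factor `r` of `d` satisfies
`v₂(ℓ_p(r)) = 1`, then `v₂(d) ≤ v₂(p+1)`; if some odd prime factor `r` of `d`
satisfies `v₂(ℓ_p(r)) > 1`, then `v₂(d) ≤ 1`. -/
theorem rank_stats_stmt1 (p : ℕ) (hp : p.Prime) (hp2 : 2 < p) (d : ℕ) (hd : 0 < d)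
    (hUp : ∃ n : ℕ, 1 ≤ n ∧ d ∣ p ^ n + 1) :
    ((∀ r : ℕ, r.Prime → Odd r → r ∣ d →
        padicValNat 2 (orderOf ((p : ZMod r))) = 1) →
      padicValNat 2 d ≤ padicValNat 2 (p + 1)) ∧
    ((∃ r : ℕ, r.Prime ∧ Odd r ∧ r ∣ d ∧
        1 < padicValNat 2 (orderOf ((p : ZMod r)))) →
      padicValNat 2 d ≤ 1) := by
  obtain ⟨n, -, hdn⟩ := hUp
  have hodd : Odd p := hp.odd_of_ne_two hp2.ne'
  have hle {m : ℕ} (h : 2 ^ m ∣ p + 1) : m ≤ padicValNat 2 (p + 1) :=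
    (padicValNat_dvd_iff_le p.succ_ne_zero).mp h
  rcases n.even_or_odd with hn | hn
  · have h1 := padicValNat_two_le_one_of_dvd_pow_add_one hodd hn hdn
    refine ⟨fun _ => h1.trans (hle ?_), fun _ => h1⟩
    simpa using (hodd.add_odd odd_one).two_dvd
  · refine ⟨fun _ => hle (two_pow_dvd_add_one_of_dvd_pow_add_one hodd hn
      (pow_padicValNat_dvd.trans hdn)), ?_⟩
    rintro ⟨r, -, -, hrd, hr⟩
    exact absurd (padicValNat_two_orderOf_le_one hn (hrd.trans hdn)) hr.not_ge
end

section
/- Let n, d be positive integers with d | n, let a be an integer with |a| > 1, let h be the largest integer for which a is an h-th power in Z, and assume gcd(d, h) = 1. Let L be the subfield of C generated over Q by a primitive n-th root of unity and a complex d-th root of a. Then the absolute value of the discriminant of the number field L satisfies |Δ(L)| ≤ (d·φ(n)·|a|)^{[L:Q]}. -/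
open NumberField Polynomial

/-- If `L = M(x)` with `x` integral, then `g'(x)` lies in the relative different of `L / M` for
every polynomial `g` over `𝓞 M` that vanishes at `x`. -/
lemma aeval_derivative_mem_differentIdeal_of_aeval_eq_zero {M L : Type*} [Field M] [NumberField M]
    [Field L] [NumberField L] [Algebra M L] (x : 𝓞 L)
    (hx : Algebra.adjoin M {algebraMap (𝓞 L) L x} = ⊤) {g : (𝓞 M)[X]} (hg : aeval x g = 0) :
    aeval x (derivative g) ∈ differentIdeal (𝓞 M) (𝓞 L) := by
  obtain ⟨q, rfl⟩ := minpoly.isIntegrallyClosed_dvd (Algebra.IsIntegral.isIntegral x) hg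
  rw [derivative_mul, map_add, map_mul, map_mul, minpoly.aeval, zero_mul, add_zero]
  exact Ideal.mul_mem_right _ _ (aeval_derivative_mem_differentIdeal (𝓞 M) M L x hx)

/-- A bound for the discriminant of a number field obtained by adjoining a `d`-th root of a nonzero
integer to a number field `M`. -/
lemma natAbs_discr_le_of_pow_eq_intCast {M L : Type*} [Field M] [NumberField M] [Field L]
    [NumberField L] [Algebra M L] {d : ℕ} (hd : 0 < d) {a : ℤ} (ha : a ≠ 0) (x : 𝓞 L)
    (hx : Algebra.adjoin M {algebraMap (𝓞 L) L x} = ⊤) (hxa : x ^ d = a) :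
    (discr L).natAbs ≤
      (d * a.natAbs) ^ Module.finrank ℚ L * (discr M).natAbs ^ Module.finrank M L := by
  rw [natAbs_discr_eq_absNorm_differentIdeal_mul_natAbs_discr_pow M (𝓞 M) L (𝓞 L)]
  refine Nat.mul_le_mul_right _ ?_
  have hmem : (d : 𝓞 L) * x ^ (d - 1) ∈ differentIdeal (𝓞 M) (𝓞 L) := by
    have := aeval_derivative_mem_differentIdeal_of_aeval_eq_zero x hx
      (g := X ^ d - C (a : 𝓞 M)) (by simp [hxa])
    rw [derivative_sub, derivative_C, derivative_X_pow] at this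
    simpa using this
  have hdvd := Ideal.absNorm_dvd_absNorm_of_le ((Ideal.span_singleton_le_iff_mem _).mpr hmem)
  have hnorm (b : ℤ) : (Algebra.norm ℤ (b : 𝓞 L)).natAbs = b.natAbs ^ Module.finrank ℚ L := by
    have := Algebra.norm_algebraMap (R := ℤ) (S := 𝓞 L) b
    rw [RingOfIntegers.rank, algebraMap_int_eq, eq_intCast] at this
    rw [this, Int.natAbs_pow]
  have hxnorm : (Algebra.norm ℤ x).natAbs ^ d = a.natAbs ^ Module.finrank ℚ L := by
    rw [← Int.natAbs_pow, ← map_pow, hxa, hnorm]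
  have hpos : 0 < (Algebra.norm ℤ x).natAbs := by
    refine Nat.pos_of_ne_zero fun h0 ↦ ?_
    rw [h0, zero_pow hd.ne'] at hxnorm
    exact (pow_pos (Int.natAbs_pos.mpr ha) _).ne hxnorm
  have hd_norm := hnorm d
  rw [Int.cast_natCast, Int.natAbs_natCast] at hd_norm
  rw [Ideal.absNorm_span_singleton, map_mul, map_pow, Int.natAbs_mul, Int.natAbs_pow, hd_norm]
    at hdvd
  refine (Nat.le_of_dvd (by positivity) hdvd).trans ?_
  rw [mul_pow, ← hxnorm]
  exact Nat.mul_le_mul_left _ (Nat.pow_le_pow_right hpos (Nat.sub_le d 1))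

lemma Nat.succ_pow_self_le_succ_mul_pow_self {m : ℕ} (hm : 1 ≤ m) :
    (m + 1) ^ m ≤ (m + 1) * m ^ m := by
  induction m, hm using Nat.le_induction with
  | base => simp
  | succ m hm ih =>
    rw [pow_succ', Nat.mul_le_mul_left_iff (by lia)]
    refine Nat.le_of_mul_le_mul_right (c := m ^ m) ?_ (by positivity)
    calc (m + 1 + 1) ^ m * m ^ m = ((m + 1 + 1) * m) ^ m := (mul_pow ..).symm
      _ ≤ ((m + 1) * (m + 1)) ^ m := Nat.pow_le_pow_left (by nlinarith) m
      _ = (m + 1) ^ m * (m + 1) ^ m := mul_pow ..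
      _ ≤ (m + 1) ^ m * ((m + 1) * m ^ m) := Nat.mul_le_mul_left _ ih
      _ = (m + 1) ^ (m + 1) * m ^ m := by ring

/-- The root discriminant of the `n`-th cyclotomic field is at most `φ(n)`. -/
lemma natAbs_discr_cyclotomic_le (n : ℕ) [NeZero n] (M : Type*) [Field M] [NumberField M]
    [IsCyclotomicExtension {n} ℚ M] :
    (discr M).natAbs ≤ n.totient ^ n.totient := by
  rw [IsCyclotomicExtension.Rat.natAbs_discr n M]
  refine Nat.div_le_of_le_mul ?_
  have hprod_pos : 0 < ∏ p ∈ n.primeFactors, p :=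
    Finset.prod_pos fun p hp ↦ (Nat.prime_of_mem_primeFactors hp).pos
  refine Nat.le_of_mul_le_mul_right (c := (∏ p ∈ n.primeFactors, p) ^ n.totient) ?_
    (pow_pos hprod_pos _)
  rw [mul_assoc, ← mul_pow n.totient, Nat.totient_mul_prod_primeFactors, mul_pow n,
    mul_left_comm]
  refine Nat.mul_le_mul_left _ ?_
  rw [← Finset.prod_pow, ← Finset.prod_pow, ← Finset.prod_mul_distrib]
  refine Finset.prod_le_prod' fun p hp ↦ ?_
  have hp' := Nat.prime_of_mem_primeFactors hp
  obtain ⟨k, hk⟩ : p - 1 ∣ n.totient := Nat.totient_prime hp' ▸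
    Nat.totient_dvd_of_dvd (Nat.dvd_of_mem_primeFactors hp)
  obtain ⟨m, rfl⟩ : ∃ m, p = m + 1 := ⟨p - 1, by have := hp'.pos; lia⟩
  have hm : 1 ≤ m := by have := hp'.two_le; lia
  rw [Nat.add_sub_cancel] at hk ⊢
  rw [hk, Nat.mul_div_cancel_left _ hm, pow_mul, pow_mul, ← mul_pow]
  exact Nat.pow_le_pow_left (Nat.succ_pow_self_le_succ_mul_pow_self hm) k

lemma IntermediateField.adjoin_pair_gens_eq_top (F : Type*) {E : Type*} [Field F] [Field E]
    [Algebra F E] (x y : E) :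
    adjoin F {(⟨x, subset_adjoin F {x, y} (by simp)⟩ : adjoin F {x, y}),
      ⟨y, subset_adjoin F {x, y} (by simp)⟩} = ⊤ := by
  apply map_injective (adjoin F {x, y}).val
  rw [adjoin_map, ← AlgHom.fieldRange_eq_map, fieldRange_val, Set.image_pair]
  rfl

/-- A bound for the discriminant of the number field generated by a primitive `n`-th root of unity
and a `d`-th root of a nonzero integer. -/
lemma natAbs_discr_le_of_adjoin_eq_top {L : Type*} [Field L] [NumberField L] {n d : ℕ}
    (hn : 0 < n) (hd : 0 < d) {a : ℤ} (ha : a ≠ 0) {ζ α : L} (hζ : IsPrimitiveRoot ζ n)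
    (hα : α ^ d = a) (htop : IntermediateField.adjoin ℚ {ζ, α} = ⊤) :
    (discr L).natAbs ≤ (d * n.totient * a.natAbs) ^ Module.finrank ℚ L := by
  have : NeZero n := ⟨hn.ne'⟩
  let M := IntermediateField.adjoin ℚ {ζ}
  have : IsCyclotomicExtension {n} ℚ M := hζ.intermediateField_adjoin_isCyclotomicExtension ℚ
  have hint : IsIntegral ℤ α := .of_pow hd (hα ▸ isIntegral_algebraMap (x := a))
  have hgen : Algebra.adjoin M {α} = ⊤ := by
    rw [← IntermediateField.adjoin_simple_toSubalgebra_of_isAlgebraic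
      (Algebra.IsAlgebraic.isAlgebraic α), ← IntermediateField.top_toSubalgebra]
    congr 1
    apply IntermediateField.restrictScalars_injective ℚ
    refine (IntermediateField.adjoin_adjoin_left ℚ {ζ} {α}).trans ?_
    rw [Set.singleton_union, htop, IntermediateField.restrictScalars_top]
  have hbound := natAbs_discr_le_of_pow_eq_intCast (M := M) hd ha (⟨α, hint⟩ : 𝓞 L) hgen
    (RingOfIntegers.ext (by simpa using! hα))
  refine hbound.trans ?_
  calc _ ≤ (d * a.natAbs) ^ Module.finrank ℚ L *
        (n.totient ^ n.totient) ^ Module.finrank M L :=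
        Nat.mul_le_mul_left _ (Nat.pow_le_pow_left (natAbs_discr_cyclotomic_le n M) _)
    _ = (d * n.totient * a.natAbs) ^ Module.finrank ℚ L := by
        rw [← pow_mul, ← IsCyclotomicExtension.Rat.finrank n M, Module.finrank_mul_finrank,
          ← mul_pow, mul_right_comm]


/-- In the setting of Lemma 3 (`d ∣ n`, `|a| > 1`, `h` the largest
integer such that `a` is an `h`-th power in `ℤ`, `gcd(d,h) = 1`), let
`L = ℚ(ζ, α) ⊆ ℂ` with `ζ` a primitive `n`-th root of unity and `α^d = a`.
Then `|Δ(L)| ≤ (d φ(n) |a|)^{[L:ℚ]}`.  (The extension `L/ℚ` is finite since it is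
generated by algebraic elements; this fact is recorded as the instance
hypothesis `NumberField ↥K`.) -/
theorem rank_stats_stmt8 (n d : ℕ) (hn : 0 < n) (hd : 0 < d) (hdn : d ∣ n)
    (a : ℤ) (ha : 1 < |a|)
    (h : ℕ) (hh : IsGreatest {k : ℕ | ∃ b : ℤ, b ^ k = a} h) (hco : Nat.Coprime d h)
    (ζ α : ℂ) (hζ : IsPrimitiveRoot ζ n) (hα : α ^ d = (a : ℂ))
    (K : IntermediateField ℚ ℂ) (hK : K = IntermediateField.adjoin ℚ ({ζ, α} : Set ℂ))
    [NumberField ↥K] :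
    |NumberField.discr ↥K|
      ≤ ((d * n.totient : ℕ) * a.natAbs : ℤ) ^ Module.finrank ℚ ↥K := by
  subst hK
  have hbound := natAbs_discr_le_of_adjoin_eq_top (L := IntermediateField.adjoin ℚ {ζ, α})
    (a := a) hn hd (by rintro rfl; simp at ha)
    (IsPrimitiveRoot.coe_submonoidClass_iff.mp hζ) (Subtype.ext (by simpa using hα))
    (IntermediateField.adjoin_pair_gens_eq_top ℚ ζ α)
  rw [Int.abs_eq_natAbs]
  exact_mod_cast hbound
end

section
/- For all positive integers m, n with m | n, the integer φ(m)/λ(m) divides the integer φ(n)/λ(n). (Here λ(m) divides φ(m) for every m, so both quotients are integers.) -/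
theorem Monoid.exponent_dvd_exponent_mul_card_ker {G H : Type*} [Group G] [Group H]
    (f : G →* H) : Monoid.exponent G ∣ Monoid.exponent H * Nat.card f.ker := by
  refine Monoid.exponent_dvd_of_forall_pow_eq_one fun g ↦ ?_
  have hg : g ^ Monoid.exponent H ∈ f.ker := by
    rw [MonoidHom.mem_ker, map_pow, Monoid.pow_exponent_eq_one]
  rw [pow_mul]
  exact congrArg Subtype.val (pow_card_eq_one' (x := (⟨_, hg⟩ : f.ker)))

theorem Group.card_div_exponent_dvd_of_surjective {G H : Type*} [Group G] [Group H] [Finite G]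
    (f : G →* H) (hf : Function.Surjective f) :
    Nat.card H / Monoid.exponent H ∣ Nat.card G / Monoid.exponent G := by
  have : Finite H := Finite.of_surjective f hf
  have hG : 0 < Monoid.exponent G := Monoid.exponent_pos.2 .of_finite
  have hH : 0 < Monoid.exponent H := Monoid.exponent_pos.2 .of_finite
  obtain ⟨a, ha⟩ := Group.exponent_dvd_nat_card (G := H)
  obtain ⟨b, hb⟩ := Group.exponent_dvd_nat_card (G := G)
  have hcard : Nat.card G = Nat.card H * Nat.card f.ker := by
    rw [Subgroup.card_eq_card_quotient_mul_card_subgroup f.ker,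
      Nat.card_congr (QuotientGroup.quotientKerEquivOfSurjective f hf).toEquiv]
  obtain ⟨c, hc⟩ := Monoid.exponent_dvd_exponent_mul_card_ker f
  rw [ha, hb, Nat.mul_div_cancel_left _ hH, Nat.mul_div_cancel_left _ hG]
  refine ⟨c, Nat.eq_of_mul_eq_mul_left hG ?_⟩
  rw [← hb, hcard, ha, mul_right_comm, hc]
  ring

/-- For positive integers `m ∣ n`, the integer `φ(m)/λ(m)`
divides the integer `φ(n)/λ(n)`, where `λ(m)` is the Carmichael function, i.e.
the exponent of the multiplicative group `(ℤ/mℤ)ˣ` (which divides `φ(m)`, so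
the natural-number divisions are exact). -/
theorem rank_stats_stmt11 (m n : ℕ) (hm : 0 < m) (hn : 0 < n) (hmn : m ∣ n) :
    (Nat.totient m / Monoid.exponent (ZMod m)ˣ) ∣
      (Nat.totient n / Monoid.exponent (ZMod n)ˣ) := by
  have : NeZero m := ⟨hm.ne'⟩
  have : NeZero n := ⟨hn.ne'⟩
  simpa only [Nat.card_eq_fintype_card, ZMod.card_units_eq_totient] using
    Group.card_div_exponent_dvd_of_surjective (ZMod.unitsMap hmn) (ZMod.unitsMap_surjective hmn)
end

section
/- For every integer a with |a| > 1 there exists x_0(a) such that for all x ≥ x_0(a) and every positive integer n, the number of positive integers m ≤ x with gcd(m, a) = 1 and ℓ_a(m) = n is at most x^{1 − (3 + log_3 x)/(2·log_2 x)}. -/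
open scoped Classical

/-- The iterated logarithm: `logI 0 x = x`, `logI (ν+1) x = max (log (logI ν x)) 1`,
so that `logI 1 x = log_1 x = max (log x, 1)` and `logI ν x = log_ν x`. -/
noncomputable def logI : ℕ → ℝ → ℝ
  | 0, x => x
  | ν + 1, x => max (Real.log (logI ν x)) 1

/-- A finite set of primes `≥ b` dividing `N ≠ 0` has at most `log N / log b` elements. -/
lemma card_mul_log_le_log_of_primes_dvd {N : ℕ} (hN : N ≠ 0) {b : ℝ} (hb : 0 < b) {s : Finset ℕ}
    (hs : ∀ p ∈ s, p.Prime ∧ p ∣ N ∧ b ≤ p) : (s.card : ℝ) * Real.log b ≤ Real.log N := by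
  have h1 : (s.card : ℝ) * Real.log b ≤ ∑ p ∈ s, Real.log (p : ℝ) := by
    rw [← nsmul_eq_mul]
    exact Finset.card_nsmul_le_sum _ _ _ fun p hp => Real.log_le_log hb (hs p hp).2.2
  have h2 : ∏ p ∈ s, p ≤ N := by
    have hsub : s ⊆ N.primeFactors := fun p hp =>
      Nat.mem_primeFactors.2 ⟨(hs p hp).1, (hs p hp).2.1, hN⟩
    exact Nat.le_of_dvd (Nat.pos_of_ne_zero hN)
      ((Finset.prod_dvd_prod_of_subset _ _ _ hsub).trans (Nat.prod_primeFactors_dvd N))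
  have h3 : ∑ p ∈ s, Real.log (p : ℝ) = Real.log ((∏ p ∈ s, p : ℕ) : ℝ) := by
    push_cast
    rw [Real.log_prod]
    intro p hp
    exact_mod_cast (hs p hp).1.ne_zero
  rw [h3] at h1
  refine h1.trans (Real.log_le_log ?_ (by exact_mod_cast h2))
  exact_mod_cast Finset.prod_pos fun p hp => (hs p hp).1.pos

lemma inv_one_sub_le_exp {t : ℝ} (h0 : 0 ≤ t) (h1 : t ≤ 3 / 4) :
    (1 - t)⁻¹ ≤ Real.exp (4 * t) := by
  have h : (1 - t)⁻¹ ≤ 1 + 4 * t := by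
    rw [inv_le_iff_one_le_mul₀ (by linarith)]
    nlinarith
  linarith [Real.add_one_le_exp (4 * t)]

lemma natCast_rpow_neg_le {p : ℕ} (hp : p.Prime) {σ : ℝ} (hσ : 1 / 2 ≤ σ) :
    (p : ℝ) ^ (-σ) ≤ 3 / 4 := by
  have h2 : (2 : ℝ) ≤ p := by exact_mod_cast hp.two_le
  calc (p : ℝ) ^ (-σ) ≤ (p : ℝ) ^ (-(1 / 2) : ℝ) :=
        Real.rpow_le_rpow_of_exponent_le (by linarith) (by linarith)
    _ ≤ (2 : ℝ) ^ (-(1 / 2) : ℝ) :=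
        Real.rpow_le_rpow_of_nonpos (by norm_num) h2 (by norm_num)
    _ ≤ 3 / 4 := by
        rw [Real.rpow_neg (by norm_num), ← Real.sqrt_eq_rpow, inv_le_comm₀ (by positivity) (by norm_num)]
        exact Real.le_sqrt_of_sq_le (by norm_num)

/-- Rankin's bound: a Dirichlet sum over integers composed of the primes in `s`. -/
lemma sum_rpow_neg_le_exp {σ : ℝ} (hσ : 1 / 2 ≤ σ) {T s : Finset ℕ} (hs : ∀ p ∈ s, p.Prime)
    (hT : ∀ m ∈ T, m ≠ 0 ∧ ∀ p, p.Prime → p ∣ m → p ∈ s) :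
    ∑ m ∈ T, (m : ℝ) ^ (-σ) ≤ Real.exp (4 * ∑ p ∈ s, (p : ℝ) ^ (-σ)) := by
  let f : ℕ →* ℝ :=
    { toFun := fun m => (m : ℝ) ^ (-σ)
      map_one' := by simp
      map_mul' := fun m n => by
        push_cast
        exact Real.mul_rpow (by positivity) (by positivity) }
  have hf : ∀ m : ℕ, f m = (m : ℝ) ^ (-σ) := fun _ => rfl
  have hf0 : ∀ m : ℕ, 0 ≤ f m := fun m => by rw [hf]; positivity
  have hlt : ∀ {p : ℕ}, p.Prime → ‖f p‖ < 1 := fun {p} hp => by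
    rw [Real.norm_of_nonneg (hf0 p), hf]
    linarith [natCast_rpow_neg_le hp hσ]
  have key := (EulerProduct.summable_and_hasSum_factoredNumbers_prod_filter_prime_geometric
    hlt s).2
  have hmem : ∀ m ∈ T, m ∈ Nat.factoredNumbers s := fun m hm =>
    Nat.mem_factoredNumbers'.2 (hT m hm).2
  have h1 : ∑ m ∈ T, f m ≤ ∏ p ∈ s with p.Prime, (1 - f p)⁻¹ := by
    rw [← Finset.sum_subtype_of_mem f hmem]
    exact sum_le_hasSum _ (fun m _ => hf0 m) key
  rw [Finset.filter_true_of_mem hs] at h1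
  refine h1.trans ?_
  rw [Finset.mul_sum, Real.exp_sum]
  refine Finset.prod_le_prod (fun p hp => ?_) fun p hp => ?_
  · have := natCast_rpow_neg_le (hs p hp) hσ
    rw [hf, inv_nonneg]; linarith
  · exact inv_one_sub_le_exp (hf0 p) (natCast_rpow_neg_le (hs p hp) hσ)

lemma sum_Icc_rpow_neg_le {c : ℝ} (h0 : 0 ≤ c) (h1 : c < 1) (d : ℕ) :
    ∑ i ∈ Finset.Icc 1 d, (i : ℝ) ^ (-c) ≤ (d : ℝ) ^ (1 - c) / (1 - c) := by
  have hc : 0 < 1 - c := by linarith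
  induction d with
  | zero => simp [Real.zero_rpow hc.ne']
  | succ k ih =>
    rw [Finset.sum_Icc_succ_top (by omega)]
    have hk : (0 : ℝ) < ((k + 1 : ℕ) : ℝ) := by positivity
    have hk' : (k : ℝ) = ((k + 1 : ℕ) : ℝ) * (1 + -(1 / ((k + 1 : ℕ) : ℝ))) := by
      field_simp; push_cast; ring
    have hle : 1 / ((k + 1 : ℕ) : ℝ) ≤ 1 := by
      rw [div_le_one hk]; exact_mod_cast Nat.succ_pos k
    have hb := rpow_one_add_le_one_add_mul_self (s := -(1 / ((k + 1 : ℕ) : ℝ)))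
      (by linarith) hc.le (by linarith)
    have h2 : (k : ℝ) ^ (1 - c) ≤
        ((k + 1 : ℕ) : ℝ) ^ (1 - c) - (1 - c) * ((k + 1 : ℕ) : ℝ) ^ (-c) := by
      have e : ((k + 1 : ℕ) : ℝ) ^ (1 - c) = ((k + 1 : ℕ) : ℝ) * ((k + 1 : ℕ) : ℝ) ^ (-c) := by
        rw [sub_eq_add_neg, Real.rpow_add hk, Real.rpow_one]
      calc (k : ℝ) ^ (1 - c) = ((k + 1 : ℕ) : ℝ) ^ (1 - c) *
            (1 + -(1 / ((k + 1 : ℕ) : ℝ))) ^ (1 - c) := by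
            rw [← Real.mul_rpow hk.le (by linarith), ← hk']
        _ ≤ ((k + 1 : ℕ) : ℝ) ^ (1 - c) * (1 + (1 - c) * -(1 / ((k + 1 : ℕ) : ℝ))) := by
            gcongr
        _ = _ := by rw [e]; field_simp; ring
    have h3 : (k : ℝ) ^ (1 - c) / (1 - c) ≤
        (((k + 1 : ℕ) : ℝ) ^ (1 - c) - (1 - c) * ((k + 1 : ℕ) : ℝ) ^ (-c)) / (1 - c) := by gcongr
    rw [sub_div, mul_div_cancel_left₀ _ hc.ne'] at h3
    linarith

/-- Primes modulo which `a` has order `d`. -/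
lemma sum_rpow_neg_orderOf_eq_le {a : ℤ} (ha : 1 < |a|) {d : ℕ} (hd : 0 < d) {U : Finset ℕ}
    (hU : ∀ p ∈ U, p.Prime ∧ ¬ (p : ℤ) ∣ a ∧ orderOf (a : ZMod p) = d)
    {c : ℝ} (h0 : 0 ≤ c) (h1 : c < 1) :
    ∑ p ∈ U, (p : ℝ) ^ (-c) ≤ (4 * |(a : ℝ)| + 1 / (1 - c)) * (d : ℝ) ^ (-(2 * c - 1)) := by
  have hd' : (0 : ℝ) < d := by exact_mod_cast hd
  have hdvd : ∀ p ∈ U, d ∣ p - 1 := fun p hp => by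
    obtain ⟨hp1, hp2, hp3⟩ := hU p hp
    have := Fact.mk hp1
    rw [← hp3]
    refine orderOf_dvd_of_pow_eq_one (ZMod.pow_card_sub_one_eq_one ?_)
    rwa [Ne, ZMod.intCast_zmod_eq_zero_iff_dvd]
  have hpow : ∀ p ∈ U, p ∣ (a ^ d - 1).natAbs := fun p hp => by
    obtain ⟨hp1, hp2, hp3⟩ := hU p hp
    rw [← Int.natCast_dvd, ← ZMod.intCast_zmod_eq_zero_iff_dvd]
    push_cast
    rw [← hp3, pow_orderOf_eq_one, sub_self]
  have hapos : 1 < |(a : ℝ)| := by exact_mod_cast ha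
  have hne : (a ^ d - 1).natAbs ≠ 0 := by
    rw [Int.natAbs_ne_zero, sub_ne_zero]
    intro h
    have h' : |a| ^ d = 1 := by rw [← abs_pow, h, abs_one]
    have := one_lt_pow₀ ha hd.ne'
    omega
  have hcard : (U.card : ℝ) ≤ 4 * |(a : ℝ)| * d := by
    have h := card_mul_log_le_log_of_primes_dvd hne (b := 2) (by norm_num) (s := U)
      fun p hp => ⟨(hU p hp).1, hpow p hp, by exact_mod_cast (hU p hp).1.two_le⟩
    have hN : (((a ^ d - 1).natAbs : ℕ) : ℝ) ≤ (2 * |(a : ℝ)|) ^ d := by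
      rw [Nat.cast_natAbs]
      push_cast
      have h4 : |(a : ℝ) ^ d - 1| ≤ |(a : ℝ)| ^ d + 1 := by
        have := abs_sub ((a : ℝ) ^ d) 1
        rwa [abs_pow, abs_one] at this
      have h5 : 1 ≤ |(a : ℝ)| ^ d := one_le_pow₀ hapos.le
      have h6 : (2 : ℝ) ≤ 2 ^ d := by
        calc (2 : ℝ) = 2 ^ 1 := by norm_num
          _ ≤ 2 ^ d := pow_le_pow_right₀ (by norm_num) hd
      rw [mul_pow]
      nlinarith
    have hlog : Real.log (((a ^ d - 1).natAbs : ℕ) : ℝ) ≤ d * (2 * |(a : ℝ)|) := by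
      refine (Real.log_le_log (by exact_mod_cast Nat.pos_of_ne_zero hne) hN).trans ?_
      rw [Real.log_pow]
      gcongr
      have := Real.log_le_sub_one_of_pos (x := 2 * |(a : ℝ)|) (by positivity)
      linarith
    have hl2 := Real.log_two_gt_d9
    nlinarith [Nat.cast_nonneg (α := ℝ) U.card]
  have hexp : (d : ℝ) ^ (-(2 * c - 1)) = d * (d : ℝ) ^ (-(2 * c)) := by
    rw [show -(2 * c - 1) = 1 + -(2 * c) by ring, Real.rpow_add hd', Real.rpow_one]
  rw [← Finset.sum_filter_add_sum_filter_not U (fun p => d ^ 2 < p), add_mul]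
  refine add_le_add ?_ ?_
  · calc ∑ p ∈ U with d ^ 2 < p, (p : ℝ) ^ (-c)
        ≤ ∑ p ∈ U with d ^ 2 < p, (d : ℝ) ^ (-(2 * c)) := by
          refine Finset.sum_le_sum fun p hp => ?_
          have hp := (Finset.mem_filter.1 hp).2
          have e : (d : ℝ) ^ (-(2 * c)) = ((d : ℝ) ^ 2) ^ (-c) := by
            rw [← Real.rpow_natCast, ← Real.rpow_mul hd'.le]; congr 1; push_cast; ring
          rw [e]
          exact Real.rpow_le_rpow_of_nonpos (by positivity) (by exact_mod_cast hp.le) (by linarith)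
      _ = ((U.filter (fun p => d ^ 2 < p)).card : ℝ) * (d : ℝ) ^ (-(2 * c)) := by
          rw [Finset.sum_const, nsmul_eq_mul]
      _ ≤ (4 * |(a : ℝ)| * d) * (d : ℝ) ^ (-(2 * c)) := by
          gcongr
          refine le_trans ?_ hcard
          exact_mod_cast Finset.card_filter_le _ _
      _ = _ := by rw [hexp]; ring
  · have hquot : ∀ p ∈ U, p - 1 = d * ((p - 1) / d) := fun p hp =>
      (Nat.mul_div_cancel' (hdvd p hp)).symm
    have hq1 : ∀ p ∈ U, 1 ≤ (p - 1) / d := fun p hp =>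
      Nat.div_pos (Nat.le_of_dvd (by have := (hU p hp).1.two_le; omega) (hdvd p hp)) hd
    calc ∑ p ∈ U with ¬ d ^ 2 < p, (p : ℝ) ^ (-c)
        ≤ ∑ p ∈ U with ¬ d ^ 2 < p, ((d : ℝ) * (((p - 1) / d : ℕ) : ℝ)) ^ (-c) := by
          refine Finset.sum_le_sum fun p hp => ?_
          have hp := (Finset.mem_filter.1 hp).1
          refine Real.rpow_le_rpow_of_nonpos ?_ ?_ (by linarith)
          · have : (0 : ℝ) < (((p - 1) / d : ℕ) : ℝ) := by exact_mod_cast hq1 p hp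
            positivity
          · have : d * ((p - 1) / d) ≤ p := by rw [← hquot p hp]; omega
            exact_mod_cast this
      _ = ∑ i ∈ (U.filter (fun p => ¬ d ^ 2 < p)).image (fun p => (p - 1) / d),
            ((d : ℝ) * (i : ℝ)) ^ (-c) := by
          rw [Finset.sum_image]
          intro p hp q hq hpq
          have hp' := (Finset.mem_filter.1 hp).1
          have hq' := (Finset.mem_filter.1 hq).1
          have e1 := hquot p hp'
          have e2 := hquot q hq'
          simp only at hpq
          rw [hpq, ← e2] at e1
          have := (hU p hp').1.two_le
          have := (hU q hq').1.two_le
          omega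
      _ ≤ ∑ i ∈ Finset.Icc 1 d, ((d : ℝ) * (i : ℝ)) ^ (-c) := by
          refine Finset.sum_le_sum_of_subset_of_nonneg ?_ fun i _ _ => by positivity
          intro i hi
          obtain ⟨p, hp, rfl⟩ := Finset.mem_image.1 hi
          obtain ⟨hp, hpd⟩ := Finset.mem_filter.1 hp
          refine Finset.mem_Icc.2 ⟨hq1 p hp, Nat.div_le_of_le_mul ?_⟩
          rw [sq] at hpd
          omega
      _ = (d : ℝ) ^ (-c) * ∑ i ∈ Finset.Icc 1 d, (i : ℝ) ^ (-c) := by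
          rw [Finset.mul_sum]
          exact Finset.sum_congr rfl fun i _ => Real.mul_rpow hd'.le (by positivity)
      _ ≤ (d : ℝ) ^ (-c) * ((d : ℝ) ^ (1 - c) / (1 - c)) := by
          gcongr
          exact sum_Icc_rpow_neg_le h0 h1 d
      _ = _ := by
          rw [show -(2 * c - 1) = -c + (1 - c) by ring, Real.rpow_add hd']; ring

lemma sum_rpow_neg_primes_le {δ : ℝ} (hδ : δ ≤ 1) {J : ℕ} {s : Finset ℕ}
    (hs : ∀ p ∈ s, p.Prime ∧ p < 2 ^ (J + 1)) :
    ∑ p ∈ s, (p : ℝ) ^ (-(1 - δ)) ≤ 4 * ∑ j ∈ Finset.Icc 1 J, ((2 : ℝ) ^ δ) ^ j / j := by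
  have hmaps : ∀ p ∈ s, Nat.log 2 p ∈ Finset.Icc 1 J := fun p hp => by
    obtain ⟨h1, h2⟩ := hs p hp
    refine Finset.mem_Icc.2 ⟨Nat.log_pos (by norm_num) h1.two_le, ?_⟩
    exact Nat.lt_succ_iff.1 (Nat.log_lt_of_lt_pow h1.ne_zero h2)
  rw [← Finset.sum_fiberwise_of_maps_to hmaps, Finset.mul_sum]
  refine Finset.sum_le_sum fun j hj => ?_
  have hj1 : (0 : ℝ) < j := by exact_mod_cast (Finset.mem_Icc.1 hj).1
  have hfib : ∀ p ∈ s.filter (fun p => Nat.log 2 p = j), p.Prime ∧ 2 ^ j ≤ p ∧ p < 2 ^ (j + 1) :=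
    fun p hp => by
      obtain ⟨h1, h2⟩ := Finset.mem_filter.1 hp
      refine ⟨(hs p h1).1, ?_, ?_⟩
      · rw [← h2]; exact Nat.pow_log_le_self 2 (hs p h1).1.ne_zero
      · rw [← h2]; exact Nat.lt_pow_succ_log_self (by norm_num) p
  have hcard : ((s.filter (fun p => Nat.log 2 p = j)).card : ℝ) * j ≤ 4 * 2 ^ j := by
    have h := card_mul_log_le_log_of_primes_dvd (primorial_ne_zero (2 ^ (j + 1))) (b := 2 ^ j)
      (by positivity) (s := s.filter (fun p => Nat.log 2 p = j)) fun p hp => by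
        obtain ⟨h1, h2, h3⟩ := hfib p hp
        refine ⟨h1, ?_, by exact_mod_cast h2⟩
        exact Finset.dvd_prod_of_mem _ (Finset.mem_filter.2 ⟨Finset.mem_range.2 (by omega), h1⟩)
    have h4 : Real.log (primorial (2 ^ (j + 1)) : ℝ) ≤ 4 * 2 ^ j * Real.log 2 := by
      have := primorial_le_four_pow (2 ^ (j + 1))
      refine (Real.log_le_log (by exact_mod_cast primorial_pos _)
        (Nat.cast_le (α := ℝ).2 this)).trans (le_of_eq ?_)
      push_cast
      rw [Real.log_pow, show (4 : ℝ) = 2 ^ 2 by norm_num, Real.log_pow]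
      push_cast
      ring
    rw [Real.log_pow] at h
    have hl2 : 0 < Real.log 2 := Real.log_pos (by norm_num)
    refine le_of_mul_le_mul_right ?_ hl2
    linarith
  calc ∑ p ∈ s with Nat.log 2 p = j, (p : ℝ) ^ (-(1 - δ))
      ≤ ∑ p ∈ s with Nat.log 2 p = j, ((2 : ℝ) ^ δ) ^ j / 2 ^ j := by
        refine Finset.sum_le_sum fun p hp => ?_
        have e : ((2 : ℝ) ^ δ) ^ j / 2 ^ j = ((2 : ℝ) ^ j) ^ (-(1 - δ)) := by
          rw [show -(1 - δ) = δ - 1 by ring, Real.rpow_sub (by positivity), Real.rpow_one,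
            ← Real.rpow_natCast, ← Real.rpow_natCast, ← Real.rpow_mul (by norm_num),
            ← Real.rpow_mul (by norm_num), mul_comm δ]
        rw [e]
        exact Real.rpow_le_rpow_of_nonpos (by positivity) (by exact_mod_cast (hfib p hp).2.1)
          (by linarith)
    _ = ((s.filter (fun p => Nat.log 2 p = j)).card : ℝ) * (((2 : ℝ) ^ δ) ^ j / 2 ^ j) := by
        rw [Finset.sum_const, nsmul_eq_mul]
    _ ≤ (4 * 2 ^ j / j) * (((2 : ℝ) ^ δ) ^ j / 2 ^ j) := by
        gcongr
        rwa [le_div_iff₀ hj1]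
    _ = _ := by field_simp

lemma sum_pow_div_le {r : ℝ} (hr : 1 < r) {J : ℕ} (hJ : 0 < J) :
    ∑ j ∈ Finset.Icc 1 J, r ^ j / j ≤
      √(r ^ J) * (1 + Real.log J) + 2 / J * (r ^ J * (r / (r - 1))) := by
  have hJ' : (0 : ℝ) < J := by exact_mod_cast hJ
  have hterm : ∀ j ∈ Finset.Icc 1 J, r ^ j / j ≤ √(r ^ J) * (j : ℝ)⁻¹ + 2 / J * r ^ j := by
    intro j hj
    have hj1 : (0 : ℝ) < j := by exact_mod_cast (Finset.mem_Icc.1 hj).1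
    by_cases h : 2 * j ≤ J
    · have h1 : r ^ j ≤ √(r ^ J) := by
        apply Real.le_sqrt_of_sq_le
        rw [← pow_mul]
        exact pow_le_pow_right₀ hr.le (by omega)
      have h2 : r ^ j / j ≤ √(r ^ J) * (j : ℝ)⁻¹ := by rw [div_eq_mul_inv]; gcongr
      have : 0 ≤ 2 / J * r ^ j := by positivity
      linarith
    · have h1 : (J : ℝ) ≤ 2 * j := by
        have : J ≤ 2 * j := by omega
        exact_mod_cast this
      have h2 : r ^ j / j ≤ 2 / J * r ^ j := by
        rw [div_mul_eq_mul_div, div_le_div_iff₀ hj1 hJ']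
        have : 0 < r ^ j := by positivity
        nlinarith
      have : 0 ≤ √(r ^ J) * (j : ℝ)⁻¹ := by positivity
      linarith
  refine (Finset.sum_le_sum hterm).trans ?_
  rw [Finset.sum_add_distrib, ← Finset.mul_sum, ← Finset.mul_sum]
  have hharm : ∑ j ∈ Finset.Icc 1 J, ((j : ℝ))⁻¹ ≤ 1 + Real.log J := by
    have := harmonic_le_one_add_log J
    rw [harmonic_eq_sum_Icc] at this
    push_cast at this
    exact this
  have hgeom : ∑ j ∈ Finset.Icc 1 J, r ^ j ≤ r ^ J * (r / (r - 1)) := by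
    have h1 : ∑ j ∈ Finset.Icc 1 J, r ^ j ≤ ∑ j ∈ Finset.range (J + 1), r ^ j := by
      refine Finset.sum_le_sum_of_subset_of_nonneg ?_ fun j _ _ => by positivity
      intro j hj
      have := Finset.mem_Icc.1 hj
      exact Finset.mem_range.2 (by omega)
    refine h1.trans ?_
    rw [geom_sum_eq hr.ne', ← mul_div_assoc, ← pow_succ]
    have : 0 < r - 1 := by linarith
    gcongr
    linarith
  gcongr

lemma sum_rpow_neg_primeFactors_le {t δ : ℝ} (ht : 3 ≤ t) (hδ1 : δ ≤ 1)
    (hδt : δ * t = 4 + Real.log t) {n : ℕ} (hn : n ≠ 0) (hnt : Real.log n ≤ Real.exp t) :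
    ∑ p ∈ n.primeFactors, (p : ℝ) ^ (-(1 - δ)) ≤
      Real.exp 4 + 4 * (√(Real.exp 4 * t) * (1 + Real.log (2 * t)) +
        8 * Real.exp 4 * (t / (4 + Real.log t))) := by
  have ht0 : 0 < t := by linarith
  have hlogt : 0 < Real.log t := Real.log_pos (by linarith)
  have hδ0 : 0 < δ := by
    by_contra h
    nlinarith
  have hM : Real.exp (δ * t) = Real.exp 4 * t := by
    rw [hδt, Real.exp_add, Real.exp_log ht0]
  have hl2 := Real.log_two_gt_d9
  have hl2' := Real.log_two_lt_d9
  rw [← Finset.sum_filter_add_sum_filter_not n.primeFactors (fun p : ℕ => Real.exp t ≤ (p : ℝ))]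
  refine add_le_add ?_ ?_
  · have hcard := card_mul_log_le_log_of_primes_dvd hn (Real.exp_pos t)
      (s := n.primeFactors.filter (fun p : ℕ => Real.exp t ≤ (p : ℝ))) fun p hp => by
        obtain ⟨h1, h2⟩ := Finset.mem_filter.1 hp
        exact ⟨Nat.prime_of_mem_primeFactors h1, Nat.dvd_of_mem_primeFactors h1, h2⟩
    rw [Real.log_exp] at hcard
    calc _ ≤ ∑ p ∈ n.primeFactors.filter (fun p : ℕ => Real.exp t ≤ (p : ℝ)),
            Real.exp 4 * t / Real.exp t := by
          refine Finset.sum_le_sum fun p hp => ?_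
          have hp := (Finset.mem_filter.1 hp).2
          refine (Real.rpow_le_rpow_of_nonpos (Real.exp_pos t) hp (by linarith)).trans
            (le_of_eq ?_)
          rw [← Real.exp_mul, ← hM, ← Real.exp_sub]
          congr 1
          ring
      _ = ((n.primeFactors.filter (fun p : ℕ => Real.exp t ≤ (p : ℝ))).card : ℝ) * t *
            Real.exp 4 / Real.exp t := by
          rw [Finset.sum_const, nsmul_eq_mul]; ring
      _ ≤ Real.exp t * Real.exp 4 / Real.exp t := by
          gcongr
          linarith
      _ = Real.exp 4 := by field_simp
  · set J := Nat.log 2 ⌊Real.exp t⌋₊ with hJ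
    have hfl : ⌊Real.exp t⌋₊ ≠ 0 := by
      have : 1 ≤ ⌊Real.exp t⌋₊ := Nat.le_floor (by simpa using ht0.le)
      omega
    have hlow : (2 : ℝ) ^ J ≤ Real.exp t := by
      refine le_trans ?_ (Nat.floor_le (Real.exp_pos t).le)
      exact_mod_cast Nat.pow_log_le_self 2 hfl
    have hupN : ⌊Real.exp t⌋₊ < 2 ^ (J + 1) := Nat.lt_pow_succ_log_self (by norm_num) _
    have hup : Real.exp t ≤ (2 : ℝ) ^ (J + 1) := by
      refine (Nat.lt_floor_add_one _).le.trans ?_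
      exact_mod_cast hupN
    have hJle : (J : ℝ) * Real.log 2 ≤ t := by
      rw [← Real.log_pow]
      exact (Real.log_le_iff_le_exp (by positivity)).2 hlow
    have hJge : t ≤ ((J : ℝ) + 1) * Real.log 2 := by
      have := (Real.le_log_iff_exp_le (by positivity)).2 hup
      rw [Real.log_pow] at this
      exact_mod_cast this
    have hJ2 : (J : ℝ) ≤ 2 * t := by nlinarith [Nat.cast_nonneg (α := ℝ) J]
    have hJt : t ≤ J := by nlinarith
    have hJ0 : (0 : ℝ) < J := by linarith
    have hr1 : 1 + δ / 2 ≤ (2 : ℝ) ^ δ := by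
      rw [Real.rpow_def_of_pos (by norm_num)]
      have := Real.add_one_le_exp (Real.log 2 * δ)
      nlinarith
    have hr2 : (2 : ℝ) ^ δ ≤ 2 := by
      simpa using Real.rpow_le_rpow_of_exponent_le (by norm_num : (1 : ℝ) ≤ 2) hδ1
    have hrJ : ((2 : ℝ) ^ δ) ^ J ≤ Real.exp 4 * t := by
      rw [← hM, ← Real.rpow_natCast, ← Real.rpow_mul (by norm_num), mul_comm δ,
        Real.rpow_mul (by norm_num), Real.rpow_natCast, mul_comm δ, Real.exp_mul]
      exact Real.rpow_le_rpow (by positivity) hlow hδ0.le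
    have hrr : (2 : ℝ) ^ δ / ((2 : ℝ) ^ δ - 1) ≤ 4 / δ := by
      rw [div_le_div_iff₀ (by linarith) hδ0]
      nlinarith
    refine (sum_rpow_neg_primes_le hδ1 (J := J) fun p hp => ?_).trans ?_
    · obtain ⟨h1, h2⟩ := Finset.mem_filter.1 hp
      refine ⟨Nat.prime_of_mem_primeFactors h1, lt_of_le_of_lt ?_ hupN⟩
      exact Nat.le_floor (not_le.1 h2).le
    · refine mul_le_mul_of_nonneg_left ?_ (by norm_num)
      refine (sum_pow_div_le (by linarith) (by exact_mod_cast hJ0)).trans ?_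
      have hlogJ : 0 ≤ Real.log J := Real.log_nonneg (by linarith)
      refine add_le_add ?_ ?_
      · gcongr
      · calc 2 / (J : ℝ) * (((2 : ℝ) ^ δ) ^ J * ((2 : ℝ) ^ δ / ((2 : ℝ) ^ δ - 1)))
            ≤ 2 / t * (Real.exp 4 * t * (4 / δ)) := by
              have h0 : 0 < (2 : ℝ) ^ δ - 1 := by linarith
              gcongr
          _ = 8 * Real.exp 4 * (t / (4 + Real.log t)) := by
              rw [← hδt]; field_simp; norm_num

open Filter Asymptotics in
lemma eventually_primeFactors_bound_le (ε : ℝ) (hε : 0 < ε) : ∀ᶠ t : ℝ in atTop,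
    Real.exp 4 + 4 * (√(Real.exp 4 * t) * (1 + Real.log (2 * t)) +
        8 * Real.exp 4 * (t / (4 + Real.log t))) ≤ ε * t := by
  have hconst : ∀ C : ℝ, (fun _ : ℝ => C) =o[atTop] (fun t : ℝ => t) := fun C =>
    isLittleO_const_left.2 (Or.inr (tendsto_norm_atTop_atTop.comp tendsto_id))
  have hlog : (fun t : ℝ => 1 + Real.log (2 * t)) =o[atTop] (fun t : ℝ => √t) := by
    have h1 : (fun t : ℝ => (1 + Real.log 2) + Real.log t) =o[atTop] (fun t : ℝ => √t) := by
      refine IsLittleO.add ?_ ?_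
      · exact isLittleO_const_left.2
          (Or.inr (tendsto_norm_atTop_atTop.comp Real.tendsto_sqrt_atTop))
      · simp_rw [Real.sqrt_eq_rpow]
        exact isLittleO_log_rpow_atTop (by norm_num)
    refine h1.congr' ?_ EventuallyEq.rfl
    filter_upwards [eventually_gt_atTop 0] with t ht
    rw [Real.log_mul (by norm_num) ht.ne', add_assoc]
  have hA : (fun t : ℝ => √(Real.exp 4 * t) * (1 + Real.log (2 * t))) =o[atTop]
      (fun t : ℝ => t) := by
    have h1 : (fun t : ℝ => √(Real.exp 4 * t)) =O[atTop] (fun t : ℝ => √t) := by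
      simp_rw [Real.sqrt_mul (Real.exp_pos 4).le]
      exact isBigO_const_mul_self _ _ _
    refine (h1.mul_isLittleO hlog).congr' EventuallyEq.rfl ?_
    filter_upwards [eventually_ge_atTop 0] with t ht
    exact Real.mul_self_sqrt ht
  have hB : (fun t : ℝ => t / (4 + Real.log t)) =o[atTop] (fun t : ℝ => t) := by
    have h1 : Tendsto (fun t : ℝ => (4 + Real.log t)⁻¹) atTop (nhds 0) :=
      (tendsto_atTop_add_const_left _ _ Real.tendsto_log_atTop).inv_tendsto_atTop
    have := (isBigO_refl (fun t : ℝ => t) atTop).mul_isLittleO ((isLittleO_one_iff ℝ).2 h1)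
    simpa [div_eq_mul_inv] using this
  have hall := (hconst (Real.exp 4)).add
    ((hA.add (hB.const_mul_left (8 * Real.exp 4))).const_mul_left 4)
  filter_upwards [hall.bound hε, eventually_ge_atTop 0] with t h ht
  rw [Real.norm_of_nonneg ht] at h
  exact (le_abs_self _).trans h

open Filter Asymptotics in
lemma eventually_mul_exp_half_le (C : ℝ) : ∀ᶠ t : ℝ in atTop,
    4 * ((C + t) * Real.exp (t / 2)) ≤ Real.exp t * (1 / (2 * t)) := by
  have h := (isLittleO_pow_exp_pos_mul_atTop 3 (by norm_num : (0 : ℝ) < 1 / 2)).bound one_pos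
  filter_upwards [h, eventually_ge_atTop (8 * (|C| + 1)), eventually_ge_atTop 1] with t h1 h2 h3
  rw [Real.norm_of_nonneg (by positivity), Real.norm_of_nonneg (Real.exp_pos _).le, one_mul,
    show 1 / 2 * t = t / 2 by ring] at h1
  have h4 : 8 * (C + t) * t ≤ t ^ 3 := by
    have : C + t ≤ (|C| + 1) * t := by nlinarith [le_abs_self C, abs_nonneg C]
    calc 8 * (C + t) * t ≤ 8 * ((|C| + 1) * t) * t := by gcongr
      _ = 8 * (|C| + 1) * (t * t) := by ring
      _ ≤ t * (t * t) := by gcongr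
      _ = t ^ 3 := by ring
  have e : Real.exp t = Real.exp (t / 2) * Real.exp (t / 2) := by
    rw [← Real.exp_add]; congr 1; ring
  rw [mul_one_div, le_div_iff₀ (by linarith), e]
  nlinarith [Real.exp_pos (t / 2)]

lemma card_orderOf_eq_le {a : ℤ} (ha : 1 < |a|) {x c : ℝ} (hx : 1 ≤ x) (hc : 3 / 4 ≤ c)
    (hc1 : c < 1) {n : ℕ} (hn : 0 < n) :
    (((Finset.Icc 1 ⌊x⌋₊).filter
          (fun m : ℕ => Int.gcd a (m : ℤ) = 1 ∧ orderOf ((a : ZMod m)) = n)).card : ℝ) ≤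
      x ^ c * Real.exp (4 * ((4 * |(a : ℝ)| + 1 / (1 - c)) *
        Real.exp (4 * ∑ p ∈ n.primeFactors, (p : ℝ) ^ (-(2 * c - 1))))) := by
  set S := (Finset.Icc 1 ⌊x⌋₊).filter
    (fun m : ℕ => Int.gcd a (m : ℤ) = 1 ∧ orderOf ((a : ZMod m)) = n) with hS
  set s := (Finset.Icc 1 ⌊x⌋₊).filter
    (fun p : ℕ => p.Prime ∧ ¬ (p : ℤ) ∣ a ∧ orderOf ((a : ZMod p)) ∣ n) with hs
  have hmem : ∀ m ∈ S, m ≠ 0 ∧ ∀ p, p.Prime → p ∣ m → p ∈ s := by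
    intro m hm
    obtain ⟨hm1, hm2, hm3⟩ := Finset.mem_filter.1 hm
    obtain ⟨hm4, hm5⟩ := Finset.mem_Icc.1 hm1
    refine ⟨by omega, fun p hp hpm => Finset.mem_filter.2 ⟨Finset.mem_Icc.2
      ⟨hp.one_le, (Nat.le_of_dvd (by omega) hpm).trans hm5⟩, hp, fun hpa => ?_, ?_⟩⟩
    · have := Int.dvd_coe_gcd hpa (Int.natCast_dvd_natCast.2 hpm)
      rw [hm2] at this
      exact hp.one_lt.ne' (by exact_mod_cast Int.eq_one_of_dvd_one (by positivity) this)
    · rw [← hm3]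
      have := orderOf_map_dvd (ZMod.castHom hpm (ZMod p)).toMonoidHom (a : ZMod m)
      have e : (ZMod.castHom hpm (ZMod p)).toMonoidHom (a : ZMod m) = (a : ZMod p) :=
        map_intCast (ZMod.castHom hpm (ZMod p)) a
      rwa [e] at this
  have h1 : (S.card : ℝ) ≤ x ^ c * ∑ m ∈ S, (m : ℝ) ^ (-c) := by
    rw [Finset.mul_sum, ← nsmul_one, ← Finset.sum_const]
    refine Finset.sum_le_sum fun m hm => ?_
    obtain ⟨hm4, hm5⟩ := Finset.mem_Icc.1 (Finset.mem_filter.1 hm).1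
    have hm0 : (0 : ℝ) < m := by exact_mod_cast hm4
    rw [Real.rpow_neg hm0.le, ← div_eq_mul_inv, one_le_div (by positivity)]
    exact Real.rpow_le_rpow hm0.le ((Nat.le_floor_iff (by linarith)).1 hm5) (by linarith)
  refine h1.trans ?_
  gcongr
  refine (sum_rpow_neg_le_exp (by linarith) (fun p hp => (Finset.mem_filter.1 hp).2.1) hmem).trans ?_
  gcongr
  have hmaps : ∀ p ∈ s, orderOf ((a : ZMod p)) ∈ n.divisors := fun p hp =>
    Nat.mem_divisors.2 ⟨(Finset.mem_filter.1 hp).2.2.2, hn.ne'⟩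
  rw [← Finset.sum_fiberwise_of_maps_to hmaps]
  have hc' : 0 < 1 - c := by linarith
  calc _ ≤ ∑ d ∈ n.divisors, (4 * |(a : ℝ)| + 1 / (1 - c)) * (d : ℝ) ^ (-(2 * c - 1)) := by
        refine Finset.sum_le_sum fun d hd => ?_
        refine sum_rpow_neg_orderOf_eq_le ha (Nat.pos_of_mem_divisors hd) (fun p hp => ?_)
          (by linarith) hc1
        obtain ⟨h1, h2⟩ := Finset.mem_filter.1 hp
        exact ⟨(Finset.mem_filter.1 h1).2.1, (Finset.mem_filter.1 h1).2.2.1, h2⟩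
    _ = (4 * |(a : ℝ)| + 1 / (1 - c)) * ∑ d ∈ n.divisors, (d : ℝ) ^ (-(2 * c - 1)) := by
        rw [Finset.mul_sum]
    _ ≤ _ := by
        gcongr
        refine sum_rpow_neg_le_exp (by linarith)
          (fun p hp => Nat.prime_of_mem_primeFactors hp) fun d hd => ?_
        exact ⟨(Nat.pos_of_mem_divisors hd).ne', fun p hp hpd =>
          Nat.mem_primeFactors.2 ⟨hp, hpd.trans (Nat.dvd_of_mem_divisors hd), hn.ne'⟩⟩

lemma orderOf_intCast_zmod_le {a : ℤ} {m : ℕ} (hm : 0 < m) (h : Int.gcd a (m : ℤ) = 1) :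
    orderOf (a : ZMod m) ≤ m := by
  have hu : IsUnit (a : ZMod m) :=
    (ZMod.coe_int_isUnit_iff_isCoprime a m).2 (Int.isCoprime_iff_gcd_eq_one.2 h).symm
  have hp : (a : ZMod m) ^ m.totient = 1 := by
    rw [← hu.unit_spec, ← Units.val_pow_eq_pow_val, ZMod.pow_totient, Units.val_one]
  exact (Nat.le_of_dvd (Nat.totient_pos.2 hm) (orderOf_dvd_of_pow_eq_one hp)).trans
    (Nat.totient_le m)

/-- For every integer `a` with `|a| > 1` there is `x₀(a)` such
that for all `x ≥ x₀(a)` and every positive integer `n`, the number of positive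
integers `m ≤ x` with `gcd(m, a) = 1` and `ℓ_a(m) = n` is at most
`x^{1 − (3 + log₃ x)/(2 log₂ x)}`. -/
theorem rank_stats_stmt12 (a : ℤ) (ha : 1 < |a|) :
    ∃ x0 : ℝ, ∀ x : ℝ, x0 ≤ x → ∀ n : ℕ, 0 < n →
      (((Finset.Icc 1 ⌊x⌋₊).filter
          (fun m : ℕ => Int.gcd a (m : ℤ) = 1 ∧ orderOf ((a : ZMod m)) = n)).card : ℝ)
        ≤ x ^ (1 - (3 + logI 3 x) / (2 * logI 2 x)) := by
  suffices H : ∀ᶠ x : ℝ in Filter.atTop, ∀ n : ℕ, 0 < n →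
      (((Finset.Icc 1 ⌊x⌋₊).filter
          (fun m : ℕ => Int.gcd a (m : ℤ) = 1 ∧ orderOf ((a : ZMod m)) = n)).card : ℝ)
        ≤ x ^ (1 - (3 + logI 3 x) / (2 * logI 2 x)) from Filter.eventually_atTop.1 H
  have htt : Filter.Tendsto (fun x : ℝ => Real.log (Real.log x)) Filter.atTop Filter.atTop :=
    Real.tendsto_log_atTop.comp Real.tendsto_log_atTop
  have hlogo : ∀ᶠ t : ℝ in Filter.atTop, 4 + Real.log t ≤ t / 2 := by
    have h := Real.isLittleO_log_id_atTop.bound (by norm_num : (0 : ℝ) < 1 / 4)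
    filter_upwards [h, Filter.eventually_ge_atTop 16] with t h1 h2
    rw [Real.norm_eq_abs, id, Real.norm_of_nonneg (by linarith)] at h1
    linarith [le_abs_self (Real.log t)]
  filter_upwards [Filter.eventually_gt_atTop 1, Real.tendsto_log_atTop.eventually_ge_atTop 1,
    htt.eventually_ge_atTop 3, (Real.tendsto_log_atTop.comp htt).eventually_ge_atTop 1,
    htt.eventually hlogo, htt.eventually (eventually_primeFactors_bound_le (1 / 8) (by norm_num)),
    htt.eventually (eventually_mul_exp_half_le (4 * |(a : ℝ)|))] with x hx hL ht hl3 hlt hQ hP n hn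
  simp only [Function.comp] at hl3
  have hI1 : max (Real.log x) 1 = Real.log x := max_eq_left hL
  have hI2 : max (Real.log (Real.log x)) 1 = Real.log (Real.log x) := max_eq_left (by linarith)
  simp only [logI, hI1, hI2, max_eq_left hl3]
  have hexp : Real.exp (Real.log (Real.log x)) = Real.log x := Real.exp_log (by linarith)
  set t := Real.log (Real.log x) with ht'
  have ht0 : 0 < t := by linarith
  have hx0 : 0 < x := by linarith
  set S := (Finset.Icc 1 ⌊x⌋₊).filter
    (fun m : ℕ => Int.gcd a (m : ℤ) = 1 ∧ orderOf ((a : ZMod m)) = n) with hS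
  rcases S.eq_empty_or_nonempty with hemp | ⟨m, hm⟩
  · rw [hemp]
    simpa using by positivity
  have hnx : Real.log n ≤ Real.exp t := by
    obtain ⟨hm1, hm2, hm3⟩ := Finset.mem_filter.1 hm
    obtain ⟨hm4, hm5⟩ := Finset.mem_Icc.1 hm1
    rw [hexp]
    refine Real.log_le_log (by exact_mod_cast hn) ?_
    refine le_trans ?_ ((Nat.le_floor_iff hx0.le).1 hm5)
    rw [← hm3]
    exact_mod_cast orderOf_intCast_zmod_le hm4 hm2
  have hδ0 : 0 < (4 + Real.log t) / t := by positivity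
  have hδ1 : (4 + Real.log t) / t ≤ 1 / 2 := by
    rw [div_le_iff₀ ht0]; linarith
  have hδt : (4 + Real.log t) / t * t = 4 + Real.log t := div_mul_cancel₀ _ ht0.ne'
  set δ := (4 + Real.log t) / t with hδ
  refine (card_orderOf_eq_le ha hx.le (c := 1 - δ / 2) (by linarith) (by linarith) hn).trans ?_
  have hsum := (sum_rpow_neg_primeFactors_le ht (by linarith) hδt hn.ne' hnx).trans hQ
  rw [show 2 * (1 - δ / 2) - 1 = 1 - δ by ring, show 1 - (1 - δ / 2) = δ / 2 by ring]
  have hinv : 1 / (δ / 2) ≤ t := by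
    rw [div_le_iff₀ (by linarith)]; linarith
  calc _ ≤ x ^ (1 - δ / 2) * Real.exp (4 * ((4 * |(a : ℝ)| + t) * Real.exp (t / 2))) := by
        gcongr
        linarith
    _ ≤ x ^ (1 - δ / 2) * Real.exp (Real.exp t * (1 / (2 * t))) := by gcongr
    _ = x ^ (1 - δ / 2) * x ^ (1 / (2 * t)) := by rw [hexp, ← Real.rpow_def_of_pos hx0]
    _ = x ^ (1 - (3 + Real.log t) / (2 * t)) := by
        rw [← Real.rpow_add hx0]
        congr 1
        rw [hδ]
        field_simp
        ring
end

section
/- There is an absolute constant C > 0 such that for all real z ≥ 2 and y ≥ 2, the number of primes r ≤ z for which there exist a prime ℓ and an integer k ≥ 2 with ℓ^k > y and ℓ^k | r − 1 is at most C·z·(log z)/y^{1/2}. -/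
open scoped Classical

/-- Among the powers of `l ≥ 2` exceeding `y`, the smallest one divides all the others. -/
theorem exists_gt_forall_dvd_pow {l : ℕ} (hl : 2 ≤ l) (y : ℝ) :
    ∃ q : ℕ, y < q ∧ ∀ k : ℕ, y < (l : ℝ) ^ k → q ∣ l ^ k := by
  have hex : ∃ k : ℕ, y < (l : ℝ) ^ k :=
    pow_unbounded_of_one_lt y (by exact_mod_cast (show 1 < l by omega))
  refine ⟨l ^ Nat.find hex, ?_, fun k hk ↦ pow_dvd_pow l (Nat.find_min' hex hk)⟩
  exact_mod_cast Nat.find_spec hex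

/-- The number of positive multiples of `d` up to `N` is at most `N / d`. -/
theorem card_filter_dvd_le (N d : ℕ) :
    (((Finset.Ioc 0 N).filter (d ∣ ·)).card : ℝ) ≤ (N : ℝ) / d := by
  rw [show ((Finset.Ioc 0 N).filter (d ∣ ·)).card = N / d by
    convert Nat.Ioc_filter_dvd_card_eq_div N d]
  exact Nat.cast_div_le

/-- At most `3 N / √y` positive integers up to `N` are divisible by a proper prime power
exceeding `y`. -/
theorem card_filter_exists_prime_pow_dvd_le (N : ℕ) {y : ℝ} (hy : 0 < y) :
    (((Finset.Ioc 0 N).filter (fun n : ℕ =>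
        ∃ l k : ℕ, l.Prime ∧ 2 ≤ k ∧ y < (l : ℝ) ^ k ∧ l ^ k ∣ n)).card : ℝ)
      ≤ 3 * N / √y := by
  choose! q hq hqd using fun (l : ℕ) (hl : 2 ≤ l) ↦ exists_gt_forall_dvd_pow hl y
  have hs : 0 < √y := Real.sqrt_pos.2 hy
  set m := ⌊√y⌋₊
  have hm : (m : ℝ) ≤ √y := Nat.floor_le hs.le
  have hm' : √y < m + 1 := Nat.lt_floor_add_one _
  have hsub : (Finset.Ioc 0 N).filter (fun n : ℕ =>
        ∃ l k : ℕ, l.Prime ∧ 2 ≤ k ∧ y < (l : ℝ) ^ k ∧ l ^ k ∣ n) ⊆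
      ((Finset.Ioc 1 m).biUnion fun l ↦ (Finset.Ioc 0 N).filter (q l ∣ ·)) ∪
      ((Finset.Ioo m (N + 1)).biUnion fun l ↦ (Finset.Ioc 0 N).filter (l ^ 2 ∣ ·)) := by
    intro n hn
    obtain ⟨hnN, l, k, hl, hk, hyk, hd⟩ := Finset.mem_filter.1 hn
    simp only [Finset.mem_union, Finset.mem_biUnion, Finset.mem_filter]
    rcases le_or_gt l m with hlm | hlm
    · exact .inl ⟨l, Finset.mem_Ioc.2 ⟨hl.one_lt, hlm⟩, hnN, (hqd l hl.two_le k hyk).trans hd⟩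
    · have hln : l ≤ n := Nat.le_of_dvd (Finset.mem_Ioc.1 hnN).1
        ((dvd_pow_self l (by omega)).trans hd)
      have := (Finset.mem_Ioc.1 hnN).2
      exact .inr ⟨l, Finset.mem_Ioo.2 ⟨hlm, by omega⟩, hnN, (pow_dvd_pow l hk).trans hd⟩
  have hsmall : ∑ l ∈ Finset.Ioc 1 m, (((Finset.Ioc 0 N).filter (q l ∣ ·)).card : ℝ)
      ≤ N / √y := by
    calc ∑ l ∈ Finset.Ioc 1 m, (((Finset.Ioc 0 N).filter (q l ∣ ·)).card : ℝ)
        ≤ ∑ l ∈ Finset.Ioc 1 m, (N : ℝ) / y := by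
          refine Finset.sum_le_sum fun l hl ↦ (card_filter_dvd_le N (q l)).trans ?_
          have := hq l (Finset.mem_Ioc.1 hl).1
          gcongr
      _ = ((m - 1 : ℕ) : ℝ) * (N / y) := by simp
      _ ≤ √y * (N / y) := by
          have : ((m - 1 : ℕ) : ℝ) ≤ m := by exact_mod_cast Nat.sub_le m 1
          gcongr
          exact this.trans hm
      _ = N / √y := by
          nth_rewrite 2 [← Real.mul_self_sqrt hy.le]
          field_simp
  have hlarge : ∑ l ∈ Finset.Ioo m (N + 1), (((Finset.Ioc 0 N).filter (l ^ 2 ∣ ·)).card : ℝ)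
      ≤ 2 * N / √y := by
    calc ∑ l ∈ Finset.Ioo m (N + 1), (((Finset.Ioc 0 N).filter (l ^ 2 ∣ ·)).card : ℝ)
        ≤ ∑ l ∈ Finset.Ioo m (N + 1), (N : ℝ) * ((l : ℝ) ^ 2)⁻¹ := by
          refine Finset.sum_le_sum fun l _ ↦ (card_filter_dvd_le N (l ^ 2)).trans_eq ?_
          rw [Nat.cast_pow, div_eq_mul_inv]
      _ ≤ N * (2 / (m + 1)) := by
          rw [← Finset.mul_sum]
          gcongr
          exact sum_Ioo_inv_sq_le m (N + 1)
      _ ≤ N * (2 / √y) := by gcongr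
      _ = 2 * N / √y := by ring
  have hcard := (Finset.card_le_card hsub).trans <| (Finset.card_union_le _ _).trans <|
    add_le_add Finset.card_biUnion_le Finset.card_biUnion_le
  calc _ ≤ ∑ l ∈ Finset.Ioc 1 m, (((Finset.Ioc 0 N).filter (q l ∣ ·)).card : ℝ) +
        ∑ l ∈ Finset.Ioo m (N + 1), (((Finset.Ioc 0 N).filter (l ^ 2 ∣ ·)).card : ℝ) := by
          exact_mod_cast hcard
    _ ≤ N / √y + 2 * N / √y := add_le_add hsmall hlarge
    _ = 3 * N / √y := by ring

/-- There is an absolute constant `C > 0` such that for all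
reals `z ≥ 2` and `y ≥ 2`, the number of primes `r ≤ z` for which there exist a
prime `ℓ` and an integer `k ≥ 2` with `ℓ^k > y` and `ℓ^k ∣ r − 1` is at most
`C z (log z) / y^{1/2}`. -/
theorem rank_stats_stmt17 :
    ∃ C : ℝ, 0 < C ∧ ∀ z : ℝ, 2 ≤ z → ∀ y : ℝ, 2 ≤ y →
      (((Finset.range (⌊z⌋₊ + 1)).filter (fun r : ℕ => r.Prime ∧
          ∃ l k : ℕ, l.Prime ∧ 2 ≤ k ∧ y < (l ^ k : ℝ) ∧ l ^ k ∣ r - 1)).card : ℝ)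
        ≤ C * z * Real.log z / y ^ ((1 : ℝ) / 2) := by
  refine ⟨6, by norm_num, fun z hz y hy ↦ ?_⟩
  have hshift : ((Finset.range (⌊z⌋₊ + 1)).filter (fun r : ℕ => r.Prime ∧
        ∃ l k : ℕ, l.Prime ∧ 2 ≤ k ∧ y < (l ^ k : ℝ) ∧ l ^ k ∣ r - 1)).card ≤
      ((Finset.Ioc 0 ⌊z⌋₊).filter (fun n : ℕ =>
        ∃ l k : ℕ, l.Prime ∧ 2 ≤ k ∧ y < (l : ℝ) ^ k ∧ l ^ k ∣ n)).card := by
    refine Finset.card_le_card_of_injOn (· - 1) (fun r hr ↦ ?_) (fun r hr r' hr' h ↦ ?_)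
    · obtain ⟨hrz, hrp, hdvd⟩ := Finset.mem_filter.1 hr
      have := hrp.two_le
      have := Finset.mem_range.1 hrz
      exact Finset.mem_filter.2 ⟨Finset.mem_Ioc.2 (by dsimp only; omega), hdvd⟩
    · have h₁ := (Finset.mem_filter.1 hr).2.1.two_le
      have h₂ := (Finset.mem_filter.1 hr').2.1.two_le
      dsimp only at h
      omega
  have hlog : 1 / 2 ≤ Real.log z := by
    have := Real.log_two_gt_d9
    have := Real.log_le_log (by norm_num) hz
    linarith
  have hfloor : (⌊z⌋₊ : ℝ) ≤ z := Nat.floor_le (by linarith)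
  rw [← Real.sqrt_eq_rpow]
  calc _ ≤ 3 * (⌊z⌋₊ : ℝ) / √y :=
        (Nat.cast_le.2 hshift).trans (card_filter_exists_prime_pow_dvd_le _ (by linarith))
    _ ≤ 6 * z * Real.log z / √y := by
        refine div_le_div_of_nonneg_right ?_ (Real.sqrt_nonneg y)
        nlinarith
end
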